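/- arXiv:1010.0867 — 2 statements merged into one kernel-verified Lean document; each statement's English description precedes it below -/
import Mathlib

section
/- Let a : SU(1,1) × ℝ → ℂ be smooth and compactly supported with a(−g, ρ) = a(g, ρ) for all g, ρ. Let b ≠ b' be points of S¹, let g₀ be an oriented-geodesic frame for (b', b), let r, r' ∈ ℝ, and let A : 𝔻 × ℝ → ℂ satisfy A(g·0, ρ) = a(g, ρ) for every g ∈ SU(1,1) with g·1 = b and every ρ ∈ ℝ. Define the intertwining operator ℒ by ℒa(g, R) = (2^{1+2iR}/π) ∫_ℝ ∫_ℝ ∫_ℝ (1+u²)^{−(1/2+iR)} a(g · A_{τ − log(1+u²)/2} · N_u, ρ) e^{2i(ρ−R)τ} dρ du dτ (matrix products in SU(1,1)). Then all integrals below converge absolutely and |b−b'|^{−(1+i(r+r'))} · ∫_ℝ ℒa(g₀ · A_τ, (r+r')/2) e^{i(r−r')τ} dτ = ∫_𝔻 A(z, r) · P(z,b)^{1/2+ir} · P(z,b')^{1/2+ir'} Vol(dz); that is, the Patterson–Sullivan transform of ℒa at the spectral parameters (ir, b), (ir', b') equals the Wigner transform of a at the same parameters. -/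
open Complex MeasureTheory Real

noncomputable section

attribute [local instance] Matrix.normedAddCommGroup Matrix.normedSpace

/-- Möbius action of a 2×2 complex matrix on ℂ. -/
def moeb (g : Matrix (Fin 2) (Fin 2) ℂ) (w : ℂ) : ℂ :=
  (g 0 0 * w + g 0 1) / (g 1 0 * w + g 1 1)

/-- The predicate defining SU(1,1) matrices. -/
def IsSU11 (g : Matrix (Fin 2) (Fin 2) ℂ) : Prop :=
  g 1 0 = (starRingEnd ℂ) (g 0 1) ∧ g 1 1 = (starRingEnd ℂ) (g 0 0) ∧
    ‖g 0 0‖ ^ 2 - ‖g 0 1‖ ^ 2 = 1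

/-- The geodesic-flow one-parameter subgroup of SU(1,1). -/
def Amat (τ : ℝ) : Matrix (Fin 2) (Fin 2) ℂ :=
  !![(Real.cosh (τ / 2) : ℂ), (Real.sinh (τ / 2) : ℂ);
     (Real.sinh (τ / 2) : ℂ), (Real.cosh (τ / 2) : ℂ)]

/-- The horocycle-flow one-parameter subgroup of SU(1,1). -/
def Nmat (u : ℝ) : Matrix (Fin 2) (Fin 2) ℂ :=
  !![1 + (u : ℂ) * Complex.I / 2, -((u : ℂ) * Complex.I) / 2;
     (u : ℂ) * Complex.I / 2, 1 - (u : ℂ) * Complex.I / 2]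

/-- Poisson kernel on 𝔻 × S¹. -/
def Pk (z b : ℂ) : ℝ := (1 - ‖z‖ ^ 2) / ‖z - b‖ ^ 2

/-- Hyperbolic area measure on the unit disc 𝔻. -/
def hypVol : Measure ℂ :=
  (volume.restrict (Metric.ball (0 : ℂ) 1)).withDensity
    (fun z => ENNReal.ofReal (4 / (1 - ‖z‖ ^ 2) ^ 2))

/-- `g₀` is an oriented-geodesic frame for the pair of boundary points `(b', b)`. -/
def frameFor (g₀ : Matrix (Fin 2) (Fin 2) ℂ) (b' b : ℂ) : Prop :=
  IsSU11 g₀ ∧ moeb g₀ 1 = b ∧ moeb g₀ (-1) = b' ∧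
    ‖moeb g₀ 0 - b‖ = ‖moeb g₀ 0 - b'‖

/-- The intertwining operator `ℒ`:
`ℒa(g, R) = (2^{1+2iR}/π) ∫∫∫ (1+u²)^{−(1/2+iR)}
a(g·A_{τ−log(1+u²)/2}·N_u, ρ) e^{2i(ρ−R)τ} dρ du dτ`. -/
def Lop (a : Matrix (Fin 2) (Fin 2) ℂ → ℝ → ℂ)
    (g : Matrix (Fin 2) (Fin 2) ℂ) (R : ℝ) : ℂ :=
  (2 : ℂ) ^ (1 + 2 * Complex.I * (R : ℂ)) / (Real.pi : ℂ) *
    ∫ τ : ℝ, ∫ u : ℝ, ∫ ρ : ℝ,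
      ((1 + u ^ 2 : ℝ) : ℂ) ^ (-((1 : ℂ) / 2) - Complex.I * (R : ℂ)) *
        a (g * Amat (τ - Real.log (1 + u ^ 2) / 2) * Nmat u) ρ *
        Complex.exp (2 * Complex.I * ((ρ : ℂ) - (R : ℂ)) * (τ : ℂ))

/-- A smooth compactly supported function on `E × ℝ` has a smooth compactly supported
partial derivative in the real variable. -/
theorem exists_partial_deriv {E : Type*} [NormedAddCommGroup E] [NormedSpace ℝ E]
    {F : E × ℝ → ℂ} (hF : ContDiff ℝ (⊤ : ℕ∞) F) (hc : HasCompactSupport F) :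
    ∃ G : E × ℝ → ℂ, ContDiff ℝ (⊤ : ℕ∞) G ∧ HasCompactSupport G ∧
      ∀ g ρ, HasDerivAt (fun x : ℝ => F (g, x)) (G (g, ρ)) ρ := by
  refine ⟨fun p => fderiv ℝ F p (0, 1), ?_, hc.fderiv_apply (𝕜 := ℝ) (0, 1), fun g ρ => ?_⟩
  · exact (hF.fderiv_right (m := (⊤ : ℕ∞)) (by simp)).clm_apply contDiff_const
  · have h1 : HasFDerivAt F (fderiv ℝ F (g, ρ)) (g, ρ) :=
      (hF.differentiable (by simp) _).hasFDerivAt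
    have h2 : HasDerivAt (fun x : ℝ => (g, x)) ((0 : E), (1 : ℝ)) ρ :=
      (hasDerivAt_const ρ g).prodMk (hasDerivAt_id ρ)
    exact h1.comp_hasDerivAt ρ h2

/-- The slices of a compactly supported function are uniformly supported in a bounded set. -/
theorem exists_support_bound {E : Type*} [NormedAddCommGroup E]
    {F : E × ℝ → ℂ} (hc : HasCompactSupport F) :
    ∃ M : ℝ, 0 ≤ M ∧ ∀ g ρ, F (g, ρ) ≠ 0 → ‖g‖ ≤ M ∧ |ρ| ≤ M := by
  obtain ⟨M, hM⟩ := hc.isCompact.isBounded.exists_norm_le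
  refine ⟨max M 0, le_max_right _ _, fun g ρ h => ?_⟩
  have h1 : ‖(g, ρ)‖ ≤ M := hM _ (subset_tsupport F h)
  rw [Prod.norm_def] at h1
  exact ⟨((le_max_left _ _).trans h1).trans (le_max_left _ _),
    ((le_max_right _ _).trans h1).trans (le_max_left _ _)⟩

theorem hasCompactSupport_slice {E : Type*} [NormedAddCommGroup E]
    {F : E × ℝ → ℂ} (hc : HasCompactSupport F) (g : E) :
    HasCompactSupport fun x : ℝ => F (g, x) := by
  obtain ⟨M, -, hM⟩ := exists_support_bound hc
  refine HasCompactSupport.intro (isCompact_Icc (a := -M) (b := M)) fun x hx => ?_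
  by_contra h
  exact hx (abs_le.1 (hM g x h).2)

theorem exists_integral_bound {E : Type*} [NormedAddCommGroup E]
    {F : E × ℝ → ℂ} (hF : Continuous F) (hc : HasCompactSupport F) :
    ∃ C : ℝ, 0 ≤ C ∧ ∀ (g : E) (e : ℝ → ℂ), (∀ ρ, ‖e ρ‖ = 1) →
      ‖∫ ρ : ℝ, F (g, ρ) * e ρ‖ ≤ C := by
  obtain ⟨M, hM0, hM⟩ := exists_support_bound hc
  obtain ⟨B, hB⟩ := hc.exists_bound_of_continuous hF
  have hB0 : 0 ≤ B := (norm_nonneg _).trans (hB 0)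
  refine ⟨B * (2 * M), by positivity, fun g e he => ?_⟩
  have h1 : ∫ ρ : ℝ, F (g, ρ) * e ρ = ∫ ρ in Set.Icc (-M) M, F (g, ρ) * e ρ := by
    refine (setIntegral_eq_integral_of_forall_compl_eq_zero fun x hx => ?_).symm
    by_contra h
    exact hx (abs_le.1 (hM g x (left_ne_zero_of_mul h)).2)
  rw [h1]
  refine (norm_setIntegral_le_of_norm_le_const (by simp) (C := B)
    fun x _ => by rw [norm_mul, he, mul_one]; exact hB _).trans ?_
  rw [Real.volume_real_Icc_of_le (by linarith)]
  apply le_of_eq; ring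

theorem integrable_mul_exp {f : ℝ → ℂ} (hf : Continuous f) (hc : HasCompactSupport f) (τ : ℝ) :
    Integrable fun ρ : ℝ => f ρ * Complex.exp (2 * Complex.I * ρ * τ) :=
  Continuous.integrable_of_hasCompactSupport (by fun_prop) hc.mul_right

theorem integral_deriv_mul_exp {f f' : ℝ → ℂ} (hf' : Continuous f')
    (hd : ∀ x, HasDerivAt f (f' x) x) (hc : HasCompactSupport f) (hc' : HasCompactSupport f')
    (τ : ℝ) :
    ∫ ρ : ℝ, f' ρ * Complex.exp (2 * Complex.I * ρ * τ) =
      -(2 * Complex.I * τ) * ∫ ρ : ℝ, f ρ * Complex.exp (2 * Complex.I * ρ * τ) := by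
  have hf : Continuous f := continuous_iff_continuousAt.2 fun x => (hd x).continuousAt
  have he : ∀ x : ℝ, HasDerivAt (fun ρ : ℝ => Complex.exp (2 * Complex.I * ρ * τ))
      (2 * Complex.I * τ * Complex.exp (2 * Complex.I * x * τ)) x := by
    intro x
    have h : HasDerivAt (fun ρ : ℝ => 2 * Complex.I * (ρ : ℂ) * τ) (2 * Complex.I * τ) x := by
      simpa using ((hasDerivAt_id x).ofReal_comp.const_mul (2 * Complex.I)).mul_const (τ : ℂ)
    simpa [mul_comm] using h.cexp
  have h := integral_mul_deriv_eq_deriv_mul_of_integrable (u := f) (u' := f')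
    (fun x _ => hd x) (fun x _ => he x)
    (by
      have := (integrable_mul_exp hf hc τ).const_mul (2 * Complex.I * τ)
      refine this.congr (ae_of_all _ fun x => ?_)
      simp only [Pi.mul_apply]; ring)
    (integrable_mul_exp hf' hc' τ) (integrable_mul_exp hf hc τ)
  rw [← neg_eq_iff_eq_neg] at h
  rw [← h, neg_mul, ← integral_const_mul]
  congr 2
  ext x
  ring

/-- Uniform quadratic decay of the Fourier transforms of the slices of a smooth compactly
supported function. -/
theorem exists_fourier_decay {E : Type*} [NormedAddCommGroup E] [NormedSpace ℝ E]
    {F : E × ℝ → ℂ} (hF : ContDiff ℝ (⊤ : ℕ∞) F) (hc : HasCompactSupport F) :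
    ∃ C : ℝ, 0 ≤ C ∧ ∀ (g : E) (τ : ℝ),
      ‖∫ ρ : ℝ, F (g, ρ) * Complex.exp (2 * Complex.I * ρ * τ)‖ ≤ C * (1 + τ ^ 2)⁻¹ := by
  obtain ⟨F1, hF1, hc1, hd1⟩ := exists_partial_deriv hF hc
  obtain ⟨F2, hF2, hc2, hd2⟩ := exists_partial_deriv hF1 hc1
  obtain ⟨C0, hC0, h0⟩ := exists_integral_bound hF.continuous hc
  obtain ⟨C2, hC2, h2⟩ := exists_integral_bound hF2.continuous hc2
  refine ⟨C0 + C2, by positivity, fun g τ => ?_⟩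
  have he : ∀ ρ : ℝ, ‖Complex.exp (2 * Complex.I * ρ * τ)‖ = 1 := fun ρ => by
    rw [show 2 * Complex.I * ρ * τ = ((2 * ρ * τ : ℝ) : ℂ) * Complex.I by push_cast; ring]
    exact Complex.norm_exp_ofReal_mul_I _
  have b0 := h0 g _ he
  have b2 := h2 g _ he
  rw [integral_deriv_mul_exp (by fun_prop) (hd2 g) (hasCompactSupport_slice hc1 g)
      (hasCompactSupport_slice hc2 g),
    integral_deriv_mul_exp (by fun_prop) (hd1 g) (hasCompactSupport_slice hc g)
      (hasCompactSupport_slice hc1 g)] at b2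
  simp only [norm_mul, norm_neg, Complex.norm_I, Complex.norm_real, Real.norm_eq_abs,
    Complex.norm_ofNat] at b2
  rw [← div_eq_mul_inv, le_div_iff₀ (by positivity)]
  have h3 := sq_abs τ
  have h4 := norm_nonneg (∫ ρ : ℝ, F (g, ρ) * Complex.exp (2 * Complex.I * ρ * τ))
  nlinarith [mul_nonneg (sq_nonneg τ) h4]

open scoped FourierTransform in
theorem fourier_inversion_two_mul {f : ℝ → ℂ} (hf : Continuous f) (hc : HasCompactSupport f)
    {C : ℝ} (hC : ∀ τ : ℝ,
      ‖∫ ρ : ℝ, f ρ * Complex.exp (2 * Complex.I * ρ * τ)‖ ≤ C * (1 + τ ^ 2)⁻¹) (r : ℝ) :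
    ∫ τ : ℝ, (∫ ρ : ℝ, f ρ * Complex.exp (2 * Complex.I * ρ * τ)) *
      Complex.exp (-(2 * Complex.I * r * τ)) = π * f r := by
  set h : ℝ → ℂ := fun τ => ∫ ρ : ℝ, f ρ * Complex.exp (2 * Complex.I * ρ * τ) with hdef
  have hF : ∀ w : ℝ, 𝓕 f w = h (-π * w) := by
    intro w
    rw [Real.fourier_real_eq_integral_exp_smul]
    refine integral_congr_ae (ae_of_all _ fun ρ => ?_)
    simp only [smul_eq_mul]
    rw [mul_comm]
    congr 2
    push_cast; ring
  have hm : AEStronglyMeasurable h volume := by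
    have : StronglyMeasurable fun p : ℝ × ℝ =>
        f p.2 * Complex.exp (2 * Complex.I * p.2 * p.1) :=
      Continuous.stronglyMeasurable (by fun_prop)
    exact this.integral_prod_right.aestronglyMeasurable
  have hint : Integrable h :=
    (integrable_inv_one_add_sq.const_mul C).mono' hm (ae_of_all _ hC)
  have hFint : Integrable (𝓕 f) := by
    have : 𝓕 f = fun w => h (-π * w) := funext hF
    rw [this]
    exact hint.comp_mul_left' (neg_ne_zero.2 Real.pi_ne_zero)
  have hinv := congrFun (hf.fourierInv_fourier_eq
    (hf.integrable_of_hasCompactSupport hc) hFint) r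
  rw [Real.fourierInv_eq'] at hinv
  rw [← hinv]
  have hsub := Measure.integral_comp_mul_left
    (fun τ : ℝ => h τ * Complex.exp (-(2 * Complex.I * r * τ))) (-π)
  have hpi := Real.pi_pos
  rw [abs_inv, abs_neg, abs_of_pos hpi] at hsub
  have : (∫ v : ℝ, Complex.exp (((2 * π * inner ℝ v r : ℝ) : ℂ) * Complex.I) • 𝓕 f v) =
      ∫ x : ℝ, h (-π * x) * Complex.exp (-(2 * Complex.I * r * ((-π * x : ℝ) : ℂ))) := by
    refine integral_congr_ae (ae_of_all _ fun v => ?_)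
    simp only [hF, smul_eq_mul]
    rw [mul_comm]
    congr 2
    simp
    ring
  rw [this, hsub, Complex.real_smul, ← mul_assoc, ← Complex.ofReal_mul, mul_inv_cancel₀ hpi.ne',
    Complex.ofReal_one, one_mul]

theorem ofReal_cpow_eq_exp {x : ℝ} (hx : 0 < x) (w : ℂ) :
    (x : ℂ) ^ w = Complex.exp ((Real.log x : ℂ) * w) := by
  rw [Complex.cpow_def_of_ne_zero (by exact_mod_cast hx.ne'), Complex.ofReal_log hx.le]

theorem one_add_sq_cpow (u : ℝ) (w : ℂ) :
    ((1 + u ^ 2 : ℝ) : ℂ) ^ w = Complex.exp ((Real.log (1 + u ^ 2) : ℂ) * w) :=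
  ofReal_cpow_eq_exp (by positivity) w

theorem continuous_log_one_add_sq : Continuous fun u : ℝ => Real.log (1 + u ^ 2) :=
  Continuous.log (by fun_prop) fun u => by positivity

theorem continuous_one_add_sq_cpow (w : ℂ) :
    Continuous fun u : ℝ => ((1 + u ^ 2 : ℝ) : ℂ) ^ w := by
  simp_rw [one_add_sq_cpow]
  have := continuous_log_one_add_sq
  fun_prop

theorem norm_one_add_sq_cpow_le (u R : ℝ) :
    ‖((1 + u ^ 2 : ℝ) : ℂ) ^ (-((1 : ℂ) / 2) - Complex.I * (R : ℂ))‖ ≤ 1 := by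
  rw [Complex.norm_cpow_eq_rpow_re_of_pos (by positivity)]
  refine Real.rpow_le_one_of_one_le_of_nonpos (by nlinarith [sq_nonneg u]) ?_
  simp

/-- The shear `((τ, u), σ) ↦ ((τ, u), σ + φ (τ, u))` preserves volume. -/
theorem measurePreserving_shear {φ : ℝ × ℝ → ℝ} (hφ : Continuous φ) :
    MeasurePreserving fun x : (ℝ × ℝ) × ℝ => (x.1, x.2 + φ x.1) :=
  (MeasurePreserving.id (volume : Measure (ℝ × ℝ))).skew_product (μc := volume) (μd := volume)
    (g := fun p s => s + φ p) (by fun_prop)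
    (ae_of_all _ fun p => (measurePreserving_add_right volume (φ p)).map_eq)

/-- Integration of an iterated integral along sheared lines. -/
theorem integral_shear {H : (ℝ × ℝ) × ℝ → ℂ} (hH : Integrable H) {φ : ℝ × ℝ → ℝ}
    (hφ : Continuous φ) {f : ℝ → ℂ}
    (hf : ∀ σ, Integrable (fun p => H (p, σ + φ p)) → f σ = ∫ p, H (p, σ + φ p)) :
    Integrable f ∧ ∫ σ, f σ = ∫ s, ∫ u, ∫ τ, H ((τ, u), s) := by
  have hG : Integrable fun x : (ℝ × ℝ) × ℝ => H (x.1, x.2 + φ x.1) :=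
    (measurePreserving_shear hφ).integrable_comp_of_integrable hH
  have hae : f =ᵐ[volume] fun σ => ∫ p, H (p, σ + φ p) := by
    filter_upwards [hG.prod_left_ae] with σ hσ using hf σ hσ
  refine ⟨hG.integral_prod_right.congr hae.symm, ?_⟩
  rw [integral_congr_ae hae,
    ← integral_integral_swap (f := fun p σ => H (p, σ + φ p)) hG]
  have htr : ∀ p : ℝ × ℝ, ∫ σ, H (p, σ + φ p) = ∫ s, H (p, s) := fun p =>
    integral_add_right_eq_self (fun s => H (p, s)) (φ p)
  rw [integral_congr_ae (ae_of_all _ htr)]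
  rw [integral_integral_swap (f := fun p s => H (p, s)) hH]
  refine integral_congr_ae ?_
  filter_upwards [hH.prod_left_ae] with s hs
  exact integral_prod_symm _ hs

theorem norm_exp_of_eq {z : ℂ} (x : ℝ) (h : z = x * Complex.I) : ‖Complex.exp z‖ = 1 := by
  rw [h, Complex.norm_exp_ofReal_mul_I]

section intertwining

variable {K : ℝ → ℝ → ℝ → ℂ} {S : ℝ}

theorem hasCompactSupport_of_bound
    (hS : ∀ s u ρ, K s u ρ ≠ 0 → |s| ≤ S ∧ |u| ≤ S ∧ |ρ| ≤ S) (s u : ℝ) :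
    HasCompactSupport (K s u) := by
  refine HasCompactSupport.intro (isCompact_Icc (a := -S) (b := S)) fun x hx => ?_
  by_contra h
  exact hx (abs_le.1 (hS s u x h).2.2)

theorem integrable_intertwining_kernel
    (hK : Continuous fun p : ℝ × ℝ × ℝ => K p.1 p.2.1 p.2.2)
    (hS : ∀ s u ρ, K s u ρ ≠ 0 → |s| ≤ S ∧ |u| ≤ S ∧ |ρ| ≤ S) (σ R : ℝ) :
    Integrable fun q : ℝ × ℝ × ℝ =>
      ((1 + q.2.1 ^ 2 : ℝ) : ℂ) ^ (-((1 : ℂ) / 2) - Complex.I * (R : ℂ)) *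
        K (σ + (q.1 - Real.log (1 + q.2.1 ^ 2) / 2)) q.2.1 q.2.2 *
        Complex.exp (2 * Complex.I * ((q.2.2 : ℂ) - (R : ℂ)) * (q.1 : ℂ)) := by
  have hlog := continuous_log_one_add_sq
  have hK' : Continuous fun q : ℝ × ℝ × ℝ =>
      K (σ + (q.1 - Real.log (1 + q.2.1 ^ 2) / 2)) q.2.1 q.2.2 :=
    hK.comp (g := fun p : ℝ × ℝ × ℝ => K p.1 p.2.1 p.2.2)
      (f := fun q : ℝ × ℝ × ℝ => (σ + (q.1 - Real.log (1 + q.2.1 ^ 2) / 2), q.2.1, q.2.2))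
      (by
        have : Continuous fun q : ℝ × ℝ × ℝ => Real.log (1 + q.2.1 ^ 2) :=
          hlog.comp (by fun_prop)
        fun_prop)
  have hcp : Continuous fun q : ℝ × ℝ × ℝ =>
      ((1 + q.2.1 ^ 2 : ℝ) : ℂ) ^ (-((1 : ℂ) / 2) - Complex.I * (R : ℂ)) :=
    (continuous_one_add_sq_cpow _).comp (by fun_prop : Continuous fun q : ℝ × ℝ × ℝ => q.2.1)
  refine Continuous.integrable_of_hasCompactSupport
    ((hcp.mul hK').mul (by fun_prop)) (HasCompactSupport.mul_right (HasCompactSupport.mul_left ?_))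
  set T := S + |σ| + S ^ 2
  refine HasCompactSupport.intro
    ((isCompact_Icc (a := -T) (b := T)).prod
      ((isCompact_Icc (a := -S) (b := S)).prod (isCompact_Icc (a := -S) (b := S))))
    fun q hq => ?_
  by_contra h
  obtain ⟨h1, h2, h3⟩ := hS _ _ _ h
  refine hq ⟨abs_le.1 ?_, abs_le.1 h2, abs_le.1 h3⟩
  have h4 : Real.log (1 + q.2.1 ^ 2) ≤ q.2.1 ^ 2 := by
    have := Real.log_le_sub_one_of_pos (x := 1 + q.2.1 ^ 2) (by positivity)
    linarith
  have h5 : 0 ≤ Real.log (1 + q.2.1 ^ 2) := Real.log_nonneg (by nlinarith [sq_nonneg q.2.1])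
  have h6 : q.2.1 ^ 2 ≤ S ^ 2 := by
    rw [← sq_abs]
    exact pow_le_pow_left₀ (abs_nonneg _) h2 2
  have h7 := abs_le.1 h1
  have h8 := neg_abs_le σ
  have h9 := le_abs_self σ
  rw [abs_le]
  constructor <;> linarith

theorem integral_intertwining
    (hK : Continuous fun p : ℝ × ℝ × ℝ => K p.1 p.2.1 p.2.2)
    (hS : ∀ s u ρ, K s u ρ ≠ 0 → |s| ≤ S ∧ |u| ≤ S ∧ |ρ| ≤ S)
    {C : ℝ} (hC0 : 0 ≤ C)
    (hC : ∀ s u τ : ℝ,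
      ‖∫ ρ : ℝ, K s u ρ * Complex.exp (2 * Complex.I * ρ * τ)‖ ≤ C * (1 + τ ^ 2)⁻¹)
    {r r' R : ℝ} (hR : R = (r + r') / 2) {f : ℝ → ℂ}
    (hf : ∀ σ : ℝ, f σ = (∫ τ : ℝ, ∫ u : ℝ, ∫ ρ : ℝ,
      ((1 + u ^ 2 : ℝ) : ℂ) ^ (-((1 : ℂ) / 2) - Complex.I * (R : ℂ)) *
        K (σ + (τ - Real.log (1 + u ^ 2) / 2)) u ρ *
        Complex.exp (2 * Complex.I * ((ρ : ℂ) - (R : ℂ)) * (τ : ℂ))) *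
      Complex.exp (Complex.I * ((r : ℂ) - (r' : ℂ)) * (σ : ℂ))) :
    Integrable f ∧
      ∫ σ, f σ = π * ∫ s : ℝ, ∫ u : ℝ,
        ((1 + u ^ 2 : ℝ) : ℂ) ^ (-((1 : ℂ) / 2) - Complex.I * (r' : ℂ)) *
          Complex.exp (Complex.I * ((r : ℂ) - (r' : ℂ)) * (s : ℂ)) * K s u r := by
  set h : ℝ → ℝ → ℝ → ℂ := fun s u τ =>
    ∫ ρ : ℝ, K s u ρ * Complex.exp (2 * Complex.I * ρ * τ) with hh
  set H : (ℝ × ℝ) × ℝ → ℂ := fun x =>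
    ((1 + x.1.2 ^ 2 : ℝ) : ℂ) ^ (-((1 : ℂ) / 2) - Complex.I * (R : ℂ)) *
      h x.2 x.1.2 x.1.1 * Complex.exp (-(2 * Complex.I * R * x.1.1)) *
      Complex.exp (Complex.I * ((r : ℂ) - (r' : ℂ)) *
        ((x.2 : ℂ) - x.1.1 + (Real.log (1 + x.1.2 ^ 2) : ℂ) / 2)) with hHdef
  have hlog := continuous_log_one_add_sq
  have hlog' : Continuous fun x : (ℝ × ℝ) × ℝ => Real.log (1 + x.1.2 ^ 2) :=
    hlog.comp (by fun_prop)
  have hcp : Continuous fun x : (ℝ × ℝ) × ℝ =>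
      ((1 + x.1.2 ^ 2 : ℝ) : ℂ) ^ (-((1 : ℂ) / 2) - Complex.I * (R : ℂ)) :=
    (continuous_one_add_sq_cpow _).comp (by fun_prop : Continuous fun x : (ℝ × ℝ) × ℝ => x.1.2)
  have hhm : StronglyMeasurable fun x : (ℝ × ℝ) × ℝ => h x.2 x.1.2 x.1.1 := by
    have hc : Continuous fun y : ((ℝ × ℝ) × ℝ) × ℝ => K y.1.2 y.1.1.2 y.2 :=
      hK.comp (g := fun p : ℝ × ℝ × ℝ => K p.1 p.2.1 p.2.2)
        (f := fun y : ((ℝ × ℝ) × ℝ) × ℝ => (y.1.2, y.1.1.2, y.2)) (by fun_prop)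
    have : StronglyMeasurable fun y : ((ℝ × ℝ) × ℝ) × ℝ =>
        K y.1.2 y.1.1.2 y.2 * Complex.exp (2 * Complex.I * y.2 * y.1.1.1) :=
      Continuous.stronglyMeasurable (by fun_prop)
    exact this.integral_prod_right
  have hHm : AEStronglyMeasurable H volume := by
    refine (((hcp.stronglyMeasurable.mul hhm).mul (Continuous.stronglyMeasurable ?_)).mul
      (Continuous.stronglyMeasurable ?_)).aestronglyMeasurable
    · fun_prop
    · fun_prop
  have hind : Integrable ((Set.Icc (-S) S).indicator fun _ : ℝ => (1 : ℝ)) :=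
    (integrable_indicator_iff measurableSet_Icc).2 (integrableOn_const (by simp))
  have hHint : Integrable H := by
    have hb := (((integrable_inv_one_add_sq.const_mul C).mul_prod hind).mul_prod hind)
    refine hb.mono' hHm (ae_of_all _ fun x => ?_)
    obtain ⟨⟨τ, u⟩, s⟩ := x
    simp only [hHdef, norm_mul]
    rw [norm_exp_of_eq (-(2 * R * τ)) (by push_cast; ring),
      norm_exp_of_eq ((r - r') * (s - τ + Real.log (1 + u ^ 2) / 2)) (by push_cast; ring),
      mul_one, mul_one]
    by_cases hsu : |s| ≤ S ∧ |u| ≤ S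
    · rw [Set.indicator_of_mem (show u ∈ Set.Icc (-S) S from abs_le.1 hsu.2),
        Set.indicator_of_mem (show s ∈ Set.Icc (-S) S from abs_le.1 hsu.1), mul_one, mul_one]
      calc _ ≤ 1 * (C * (1 + τ ^ 2)⁻¹) :=
            mul_le_mul (norm_one_add_sq_cpow_le u R) (hC s u τ) (norm_nonneg _) zero_le_one
        _ = _ := one_mul _
    · have h0 : h s u τ = 0 := by
        simp only [hh]
        refine integral_eq_zero_of_ae (ae_of_all _ fun ρ => ?_)
        have : K s u ρ = 0 := by
          by_contra hne
          exact hsu ⟨(hS _ _ _ hne).1, (hS _ _ _ hne).2.1⟩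
        simp [this]
      rw [h0, norm_zero, mul_zero]
      have hi : ∀ x : ℝ, 0 ≤ (Set.Icc (-S) S).indicator (fun _ : ℝ => (1 : ℝ)) x :=
        Set.indicator_nonneg fun _ _ => zero_le_one
      have := hi u
      have := hi s
      positivity
  have key := integral_shear hHint (φ := fun p => p.1 - Real.log (1 + p.2 ^ 2) / 2)
    (by
      have : Continuous fun p : ℝ × ℝ => Real.log (1 + p.2 ^ 2) := hlog.comp (by fun_prop)
      fun_prop) (f := f) (fun σ hσ => by
      rw [hf, Measure.volume_eq_prod, integral_prod _ hσ, ← integral_mul_const]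
      refine integral_congr_ae (ae_of_all _ fun τ => ?_)
      simp only
      rw [← integral_mul_const]
      refine integral_congr_ae (ae_of_all _ fun u => ?_)
      simp only [hHdef, hh]
      rw [← integral_mul_const, ← integral_const_mul, ← integral_mul_const, ← integral_mul_const]
      refine integral_congr_ae (ae_of_all _ fun ρ => ?_)
      simp only
      rw [show 2 * Complex.I * ((ρ : ℂ) - R) * τ =
        2 * Complex.I * ρ * τ + -(2 * Complex.I * R * τ) by ring, Complex.exp_add,
        show ((σ + (τ - Real.log (1 + u ^ 2) / 2) : ℝ) : ℂ) - τ +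
          (Real.log (1 + u ^ 2) : ℂ) / 2 = σ by push_cast; ring]
      ring)
  refine ⟨key.1, ?_⟩
  rw [key.2, ← integral_const_mul]
  refine integral_congr_ae (ae_of_all _ fun s => ?_)
  simp only
  rw [← integral_const_mul]
  refine integral_congr_ae (ae_of_all _ fun u => ?_)
  simp only [hHdef]
  have hKsu : Continuous (K s u) :=
    hK.comp (g := fun p : ℝ × ℝ × ℝ => K p.1 p.2.1 p.2.2)
      (f := fun ρ : ℝ => (s, u, ρ)) (by fun_prop)
  have hinv := fourier_inversion_two_mul hKsu (hasCompactSupport_of_bound hS s u) (hC s u) r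
  have hE : ∀ τ : ℝ, ((1 + u ^ 2 : ℝ) : ℂ) ^ (-((1 : ℂ) / 2) - Complex.I * (R : ℂ)) *
      h s u τ * Complex.exp (-(2 * Complex.I * R * τ)) *
      Complex.exp (Complex.I * ((r : ℂ) - (r' : ℂ)) *
        ((s : ℂ) - τ + (Real.log (1 + u ^ 2) : ℂ) / 2)) =
      (((1 + u ^ 2 : ℝ) : ℂ) ^ (-((1 : ℂ) / 2) - Complex.I * (r' : ℂ)) *
          Complex.exp (Complex.I * ((r : ℂ) - (r' : ℂ)) * (s : ℂ))) *
        (h s u τ * Complex.exp (-(2 * Complex.I * r * τ))) := by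
    intro τ
    rw [one_add_sq_cpow, one_add_sq_cpow]
    have : ∀ a b c d e f g : ℂ, a + c + d = e + f + g →
        Complex.exp a * b * Complex.exp c * Complex.exp d =
          Complex.exp e * Complex.exp f * (b * Complex.exp g) := by
      intro a b c d e f g habc
      have := congrArg Complex.exp habc
      simp only [Complex.exp_add] at this
      linear_combination b * this
    apply this
    rw [hR]
    push_cast
    ring
  simp_rw [hE]
  rw [integral_const_mul, hinv]
  ring

theorem integrable_intertwining_slice
    (hK : Continuous fun p : ℝ × ℝ × ℝ => K p.1 p.2.1 p.2.2)
    (hS : ∀ s u ρ, K s u ρ ≠ 0 → |s| ≤ S ∧ |u| ≤ S ∧ |ρ| ≤ S) (r r' : ℝ) :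
    Integrable fun x : ℝ × ℝ =>
      ((1 + x.2 ^ 2 : ℝ) : ℂ) ^ (-((1 : ℂ) / 2) - Complex.I * (r' : ℂ)) *
        Complex.exp (Complex.I * ((r : ℂ) - (r' : ℂ)) * (x.1 : ℂ)) * K x.1 x.2 r := by
  have h1 : Continuous fun x : ℝ × ℝ =>
      ((1 + x.2 ^ 2 : ℝ) : ℂ) ^ (-((1 : ℂ) / 2) - Complex.I * (r' : ℂ)) :=
    (continuous_one_add_sq_cpow _).comp (by fun_prop : Continuous fun x : ℝ × ℝ => x.2)
  have h2 : Continuous fun x : ℝ × ℝ => K x.1 x.2 r :=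
    hK.comp (g := fun p : ℝ × ℝ × ℝ => K p.1 p.2.1 p.2.2)
      (f := fun x : ℝ × ℝ => (x.1, x.2, r)) (by fun_prop)
  refine Continuous.integrable_of_hasCompactSupport ((h1.mul (by fun_prop)).mul h2)
    (HasCompactSupport.mul_left (HasCompactSupport.intro
      ((isCompact_Icc (a := -S) (b := S)).prod (isCompact_Icc (a := -S) (b := S))) fun x hx => ?_))
  by_contra h
  obtain ⟨h3, h4, -⟩ := hS _ _ _ h
  exact hx ⟨abs_le.1 h3, abs_le.1 h4⟩

end intertwining

open ComplexConjugate in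
/-- The Cayley-type transform `w ↦ (p w - q) / (p̄ w + q̄)` from the right half-plane to the disc. -/
def cay (p q w : ℂ) : ℂ := (p * w - q) / (conj p * w + conj q)

/-- Horocyclic coordinates on the right half-plane. -/
def horo (s u : ℝ) : ℂ := (Real.exp s : ℂ) * (1 - (u : ℂ) * Complex.I)

@[simp] theorem horo_re (s u : ℝ) : (horo s u).re = Real.exp s := by
  simp [horo, -Complex.ofReal_exp]

@[simp] theorem horo_im (s u : ℝ) : (horo s u).im = -(Real.exp s * u) := by
  simp [horo, -Complex.ofReal_exp]

section disc

open ComplexConjugate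

variable {p q : ℂ}

theorem normSq_cay_den (hpq : p * conj q + q * conj p = 2) (w : ℂ) :
    Complex.normSq (conj p * w + conj q) = Complex.normSq (p * w - q) + 4 * w.re := by
  have h := congrArg Complex.re hpq
  simp at h
  simp only [Complex.normSq_apply, Complex.add_re, Complex.add_im, Complex.sub_re, Complex.sub_im,
    Complex.mul_re, Complex.mul_im, Complex.conj_re, Complex.conj_im]
  linear_combination (2 * w.re) * h

theorem cay_den_ne_zero (hpq : p * conj q + q * conj p = 2) {w : ℂ} (hw : 0 < w.re) :
    conj p * w + conj q ≠ 0 := by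
  intro h
  have := normSq_cay_den hpq w
  rw [h, map_zero] at this
  linarith [Complex.normSq_nonneg (p * w - q)]

theorem left_ne_zero_of_pair (hpq : p * conj q + q * conj p = 2) : p ≠ 0 := by
  rintro rfl; simp at hpq

theorem right_ne_zero_of_pair (hpq : p * conj q + q * conj p = 2) : q ≠ 0 := by
  rintro rfl; simp at hpq

theorem one_sub_norm_cay_sq (hpq : p * conj q + q * conj p = 2) {w : ℂ} (hw : 0 < w.re) :
    1 - ‖cay p q w‖ ^ 2 = 4 * w.re / ‖conj p * w + conj q‖ ^ 2 := by
  have h0 : ‖conj p * w + conj q‖ ≠ 0 := norm_ne_zero_iff.2 (cay_den_ne_zero hpq hw)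
  have h := normSq_cay_den hpq w
  rw [Complex.normSq_eq_norm_sq, Complex.normSq_eq_norm_sq] at h
  rw [cay, norm_div, div_pow, eq_div_iff (pow_ne_zero 2 h0), sub_mul,
    div_mul_cancel₀ _ (pow_ne_zero 2 h0)]
  linarith

theorem norm_cay_lt_one (hpq : p * conj q + q * conj p = 2) {w : ℂ} (hw : 0 < w.re) :
    ‖cay p q w‖ < 1 := by
  have h := one_sub_norm_cay_sq hpq hw
  have h0 : 0 < ‖conj p * w + conj q‖ := norm_pos_iff.2 (cay_den_ne_zero hpq hw)
  have : 0 < 1 - ‖cay p q w‖ ^ 2 := by rw [h]; positivity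
  nlinarith [norm_nonneg (cay p q w)]

theorem Pk_cay_left (hpq : p * conj q + q * conj p = 2) {w : ℂ} (hw : 0 < w.re) :
    Pk (cay p q w) (p / conj p) = w.re * ‖p‖ ^ 2 := by
  have hp := left_ne_zero_of_pair hpq
  have hp' : conj p ≠ 0 := by simpa using hp
  have hd := cay_den_ne_zero hpq hw
  have h1 : cay p q w - p / conj p = -2 / (conj p * (conj p * w + conj q)) := by
    rw [cay, div_sub_div _ _ hd hp', div_eq_div_iff (mul_ne_zero hd hp') (mul_ne_zero hp' hd)]
    linear_combination -(conj p * (conj p * w + conj q)) * hpq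
  have h2 : ‖p‖ ≠ 0 := norm_ne_zero_iff.2 hp
  have h3 : ‖conj p * w + conj q‖ ≠ 0 := norm_ne_zero_iff.2 hd
  rw [Pk, h1, one_sub_norm_cay_sq hpq hw, norm_div, norm_mul, norm_neg, RCLike.norm_conj,
    Complex.norm_ofNat]
  field_simp
  norm_num

theorem Pk_cay_right (hpq : p * conj q + q * conj p = 2) {w : ℂ} (hw : 0 < w.re) :
    Pk (cay p q w) (-q / conj q) = w.re * ‖q‖ ^ 2 / ‖w‖ ^ 2 := by
  have hq := right_ne_zero_of_pair hpq
  have hq' : conj q ≠ 0 := by simpa using hq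
  have hd := cay_den_ne_zero hpq hw
  have hw0 : w ≠ 0 := by rintro rfl; simp at hw
  have h1 : cay p q w - -q / conj q = 2 * w / (conj q * (conj p * w + conj q)) := by
    rw [cay, div_sub_div _ _ hd hq', div_eq_div_iff (mul_ne_zero hd hq') (mul_ne_zero hq' hd)]
    linear_combination w * conj q * (conj p * w + conj q) * hpq
  have h2 : ‖q‖ ≠ 0 := norm_ne_zero_iff.2 hq
  have h3 : ‖conj p * w + conj q‖ ≠ 0 := norm_ne_zero_iff.2 hd
  have h4 : ‖w‖ ≠ 0 := norm_ne_zero_iff.2 hw0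
  rw [Pk, h1, one_sub_norm_cay_sq hpq hw, norm_div, norm_mul, norm_mul, RCLike.norm_conj,
    Complex.norm_ofNat]
  field_simp
  norm_num

theorem cay_injective (hpq : p * conj q + q * conj p = 2) {w w' : ℂ} (hw : 0 < w.re)
    (hw' : 0 < w'.re) (h : cay p q w = cay p q w') : w = w' := by
  have hd := cay_den_ne_zero hpq hw
  have hd' := cay_den_ne_zero hpq hw'
  rw [cay, cay, div_eq_div_iff hd hd'] at h
  linear_combination h / 2 - (w - w') / 2 * hpq

theorem exists_cay_eq (hpq : p * conj q + q * conj p = 2) {z : ℂ} (hz : ‖z‖ < 1) :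
    ∃ w : ℂ, 0 < w.re ∧ cay p q w = z := by
  have hp := left_ne_zero_of_pair hpq
  have hd : p - conj p * z ≠ 0 := by
    intro h
    have h1 : ‖p‖ = ‖p‖ * ‖z‖ := by
      rw [← RCLike.norm_conj p, ← norm_mul, ← sub_eq_zero.1 h, RCLike.norm_conj]
    have h2 : 0 < ‖p‖ := norm_pos_iff.2 hp
    nlinarith
  have hN : 0 < Complex.normSq (p - conj p * z) := Complex.normSq_pos.2 hd
  have hre : 0 < ((q + conj q * z) / (p - conj p * z)).re := by
    rw [Complex.div_re, ← add_div]
    refine div_pos ?_ hN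
    have h := congrArg Complex.re hpq
    simp at h
    have hz2 : z.re * z.re + z.im * z.im < 1 := by
      rw [← Complex.normSq_apply, Complex.normSq_eq_norm_sq]
      nlinarith [norm_nonneg z]
    simp only [Complex.add_re, Complex.add_im, Complex.sub_re, Complex.sub_im,
      Complex.mul_re, Complex.mul_im, Complex.conj_re, Complex.conj_im]
    have h' : p.re * q.re + p.im * q.im = 1 := by linarith
    have : (q.re + (q.re * z.re - -q.im * z.im)) * (p.re - (p.re * z.re - -p.im * z.im)) +
        (q.im + (q.re * z.im + -q.im * z.re)) * (p.im - (p.re * z.im + -p.im * z.re)) =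
        1 - (z.re * z.re + z.im * z.im) := by
      linear_combination (1 - (z.re * z.re + z.im * z.im)) * h'
    linarith
  refine ⟨_, hre, ?_⟩
  have hd2 := cay_den_ne_zero hpq hre
  rw [cay, div_eq_iff hd2]
  linear_combination div_mul_cancel₀ (q + conj q * z) hd

theorem hasDerivAt_cay (hpq : p * conj q + q * conj p = 2) {w : ℂ} (hw : 0 < w.re) :
    HasDerivAt (cay p q) (2 / (conj p * w + conj q) ^ 2) w := by
  have hd := cay_den_ne_zero hpq hw
  have h1 : HasDerivAt (fun w => p * w - q) p w := by
    simpa using ((hasDerivAt_id w).const_mul p).sub_const q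
  have h2 : HasDerivAt (fun w => conj p * w + conj q) (conj p) w := by
    simpa using ((hasDerivAt_id w).const_mul (conj p)).add_const (conj q)
  refine (h1.div h2 hd).congr_deriv ?_
  congr 1
  linear_combination hpq

/-- The derivative of `ζ ↦ horo ζ.re ζ.im`. -/
def horoDeriv (s u : ℝ) : ℂ →L[ℝ] ℂ :=
  Complex.reCLM.smulRight (horo s u) +
    Complex.imCLM.smulRight (-(Real.exp s : ℂ) * Complex.I)

theorem hasFDerivAt_horo (ζ : ℂ) :
    HasFDerivAt (fun ζ : ℂ => horo ζ.re ζ.im) (horoDeriv ζ.re ζ.im) ζ := by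
  have h1 : HasFDerivAt (fun ζ : ℂ => ((Real.exp ζ.re : ℝ) : ℂ))
      (Complex.ofRealCLM.comp (Real.exp ζ.re • Complex.reCLM)) ζ :=
    Complex.ofRealCLM.hasFDerivAt.comp ζ (Complex.reCLM.hasFDerivAt.exp)
  have h2 : HasFDerivAt (fun ζ : ℂ => 1 - (ζ.im : ℂ) * Complex.I)
      (-(Complex.imCLM.smulRight Complex.I)) ζ := by
    have h3 : HasFDerivAt (fun ζ : ℂ => (ζ.im : ℂ) * Complex.I)
        (Complex.imCLM.smulRight Complex.I) ζ := by
      have h4 : (fun ζ : ℂ => (ζ.im : ℂ) * Complex.I) = Complex.imCLM.smulRight Complex.I := by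
        ext; simp
      rw [h4]
      exact (Complex.imCLM.smulRight Complex.I).hasFDerivAt
    simpa using h3.const_sub 1
  refine (h1.mul h2).congr_fderiv ?_
  ext z
  simp [horoDeriv, horo]
  ring

theorem det_smul_horoDeriv (c : ℂ) (s u : ℝ) :
    (c • horoDeriv s u : ℂ →L[ℝ] ℂ).det = -(Complex.normSq c * Real.exp s ^ 2) := by
  rw [ContinuousLinearMap.det, ← LinearMap.det_toMatrix Complex.basisOneI, Matrix.det_fin_two]
  simp [-Complex.ofReal_exp, LinearMap.toMatrix_apply, horoDeriv, Complex.normSq_apply, Complex.coe_basisOneI_repr]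
  ring

/-- Horocyclic coordinates on the disc, as a map of the complex plane. -/
def discHoro (p q ζ : ℂ) : ℂ := cay p q (horo ζ.re ζ.im)

theorem hasFDerivAt_discHoro (hpq : p * conj q + q * conj p = 2) (ζ : ℂ) :
    HasFDerivAt (discHoro p q)
      ((2 / (conj p * horo ζ.re ζ.im + conj q) ^ 2) • horoDeriv ζ.re ζ.im : ℂ →L[ℝ] ℂ) ζ := by
  have h1 := hasDerivAt_cay hpq (w := horo ζ.re ζ.im) (by simp [Real.exp_pos])
  exact h1.comp_hasFDerivAt_of_eq ζ (hasFDerivAt_horo ζ) rfl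

theorem horo_injective {ζ ζ' : ℂ} (h : horo ζ.re ζ.im = horo ζ'.re ζ'.im) : ζ = ζ' := by
  have h1 := congrArg Complex.re h
  have h2 := congrArg Complex.im h
  simp only [horo_re, horo_im, Real.exp_eq_exp] at h1 h2
  rw [h1] at h2
  exact Complex.ext h1 (mul_left_cancel₀ (Real.exp_pos _).ne' (neg_injective h2))

theorem discHoro_injective (hpq : p * conj q + q * conj p = 2) :
    Function.Injective (discHoro p q) := fun ζ ζ' h =>
  horo_injective (cay_injective hpq (by simp [Real.exp_pos]) (by simp [Real.exp_pos]) h)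

theorem discHoro_image (hpq : p * conj q + q * conj p = 2) :
    discHoro p q '' Set.univ = Metric.ball 0 1 := by
  ext z
  simp only [Set.image_univ, Set.mem_range, mem_ball_zero_iff]
  constructor
  · rintro ⟨ζ, rfl⟩
    exact norm_cay_lt_one hpq (by simp [Real.exp_pos])
  · intro hz
    obtain ⟨w, hw, rfl⟩ := exists_cay_eq hpq hz
    refine ⟨⟨Real.log w.re, -w.im / w.re⟩, ?_⟩
    rw [discHoro]
    congr 1
    apply Complex.ext
    · simp [Real.exp_log hw]
    · simp [Real.exp_log hw, mul_div_cancel₀ _ hw.ne']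

theorem discHoro_density (hpq : p * conj q + q * conj p = 2) (ζ : ℂ) :
    |((2 / (conj p * horo ζ.re ζ.im + conj q) ^ 2) • horoDeriv ζ.re ζ.im : ℂ →L[ℝ] ℂ).det| *
      (4 / (1 - ‖discHoro p q ζ‖ ^ 2) ^ 2) = 1 := by
  have hw : 0 < (horo ζ.re ζ.im).re := by simp [Real.exp_pos]
  have hd : ‖conj p * horo ζ.re ζ.im + conj q‖ ≠ 0 := norm_ne_zero_iff.2 (cay_den_ne_zero hpq hw)
  rw [det_smul_horoDeriv, abs_neg, abs_of_nonneg (mul_nonneg (Complex.normSq_nonneg _) (sq_nonneg _)),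
    discHoro, one_sub_norm_cay_sq hpq hw, Complex.normSq_eq_norm_sq, norm_div, norm_pow, horo_re,
    Complex.norm_ofNat]
  have := (Real.exp_pos ζ.re).ne'
  field_simp
  norm_num

theorem hypVol_eq (f : ℂ → ℂ) :
    (Integrable f hypVol ↔
      IntegrableOn (fun z => (4 / (1 - ‖z‖ ^ 2) ^ 2) • f z) (Metric.ball 0 1)) ∧
    ∫ z, f z ∂hypVol = ∫ z in Metric.ball 0 1, (4 / (1 - ‖z‖ ^ 2) ^ 2) • f z := by
  have hm : Measurable fun z : ℂ => ENNReal.ofReal (4 / (1 - ‖z‖ ^ 2) ^ 2) := by fun_prop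
  have ht : ∀ z : ℂ, (ENNReal.ofReal (4 / (1 - ‖z‖ ^ 2) ^ 2)).toReal = 4 / (1 - ‖z‖ ^ 2) ^ 2 :=
    fun z => ENNReal.toReal_ofReal (by positivity)
  constructor
  · rw [hypVol, integrable_withDensity_iff_integrable_smul' hm (ae_of_all _ fun _ => by simp)]
    simp_rw [ht]
    rfl
  · rw [hypVol, integral_withDensity_eq_integral_toReal_smul hm (ae_of_all _ fun _ => by simp)]
    simp_rw [ht]

/-- In horocyclic coordinates, hyperbolic area is Lebesgue measure. -/
theorem hypVol_horocyclic (hpq : p * conj q + q * conj p = 2) (f : ℂ → ℂ) :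
    (Integrable f hypVol ↔ Integrable fun x : ℝ × ℝ => f (cay p q (horo x.1 x.2))) ∧
    ∫ z, f z ∂hypVol = ∫ x : ℝ × ℝ, f (cay p q (horo x.1 x.2)) := by
  have hder := fun ζ (_ : ζ ∈ (Set.univ : Set ℂ)) =>
    (hasFDerivAt_discHoro hpq ζ).hasFDerivWithinAt (s := Set.univ)
  have hinj := (discHoro_injective hpq).injOn (s := Set.univ)
  have hden : ∀ ζ : ℂ, |((2 / (conj p * horo ζ.re ζ.im + conj q) ^ 2) •
      horoDeriv ζ.re ζ.im : ℂ →L[ℝ] ℂ).det| •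
      ((4 / (1 - ‖discHoro p q ζ‖ ^ 2) ^ 2) • f (discHoro p q ζ)) = f (discHoro p q ζ) := by
    intro ζ
    rw [smul_smul, discHoro_density hpq, one_smul]
  have hmp := Complex.volume_preserving_equiv_real_prod.symm
  have hcomp : ∀ x : ℝ × ℝ, discHoro p q (Complex.measurableEquivRealProd.symm x) =
      cay p q (horo x.1 x.2) := fun x => rfl
  constructor
  · rw [(hypVol_eq f).1, ← discHoro_image hpq,
      integrableOn_image_iff_integrableOn_abs_det_fderiv_smul _ MeasurableSet.univ hder hinj]
    simp_rw [hden]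
    rw [integrableOn_univ, ← hmp.integrable_comp_emb (MeasurableEquiv.measurableEmbedding _)]
    rfl
  · rw [(hypVol_eq f).2, ← discHoro_image hpq,
      integral_image_eq_integral_abs_det_fderiv_smul _ MeasurableSet.univ hder hinj]
    simp_rw [hden]
    rw [setIntegral_univ, ← hmp.integral_comp (MeasurableEquiv.measurableEmbedding _)]
    rfl

end disc

section group

open ComplexConjugate

theorem isSU11_iff {g : Matrix (Fin 2) (Fin 2) ℂ} :
    IsSU11 g ↔ g 1 0 = conj (g 0 1) ∧ g 1 1 = conj (g 0 0) ∧
      g 0 0 * conj (g 0 0) - g 0 1 * conj (g 0 1) = 1 := by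
  simp only [IsSU11, Complex.mul_conj', ← Complex.ofReal_pow]
  norm_cast

theorem IsSU11.mul {g h : Matrix (Fin 2) (Fin 2) ℂ} (hg : IsSU11 g) (hh : IsSU11 h) :
    IsSU11 (g * h) := by
  rw [isSU11_iff] at *
  obtain ⟨h1, h2, h3⟩ := hg
  obtain ⟨h4, h5, h6⟩ := hh
  simp only [Matrix.mul_apply, Fin.sum_univ_two, map_add, map_mul, h1, h2, h4, h5,
    Complex.conj_conj]
  refine ⟨by ring, by ring, ?_⟩
  linear_combination (h 0 0 * conj (h 0 0) - h 0 1 * conj (h 0 1)) * h3 + h6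

theorem isSU11_Amat (τ : ℝ) : IsSU11 (Amat τ) := by
  rw [isSU11_iff]
  have h := Real.cosh_sq_sub_sinh_sq (τ / 2)
  simp only [Amat, Matrix.of_apply, Matrix.cons_val', Matrix.cons_val_zero, Matrix.cons_val_one,
    Matrix.cons_val_fin_one, Complex.conj_ofReal, true_and]
  rw [← sq, ← sq]
  exact_mod_cast h

theorem isSU11_Nmat (u : ℝ) : IsSU11 (Nmat u) := by
  rw [isSU11_iff]
  refine ⟨by simp [Nmat, map_ofNat], by simp [Nmat, sub_eq_add_neg, neg_div, map_ofNat], ?_⟩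
  simp [Nmat, map_ofNat]
  ring

theorem Amat_mul_Amat (σ τ : ℝ) : Amat σ * Amat τ = Amat (σ + τ) := by
  have h1 := Real.cosh_add (σ / 2) (τ / 2)
  have h2 := Real.sinh_add (σ / 2) (τ / 2)
  rw [← add_div] at h1 h2
  ext i j
  fin_cases i <;> fin_cases j <;>
    simp only [Amat, Matrix.mul_apply, Fin.sum_univ_two, h1, h2] <;> simp <;> ring

theorem Amat_mul_Nmat_apply_zero (s u : ℝ) : (Amat s * Nmat u) 0 0 =
    ⟨Real.cosh (s / 2), u / 2 * Real.exp (s / 2)⟩ := by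
  apply Complex.ext
  · simp [Amat, Nmat, Matrix.mul_apply, -Complex.ofReal_cosh, -Complex.ofReal_sinh]
  · simp [Amat, Nmat, Matrix.mul_apply, -Complex.ofReal_cosh, -Complex.ofReal_sinh]
    rw [← Real.cosh_add_sinh]
    ring

/-- The geodesic-horocycle coordinates of an element of a bounded set are bounded. -/
theorem exists_coord_bound {g : Matrix (Fin 2) (Fin 2) ℂ} (hg : IsSU11 g) (M : ℝ) :
    ∃ S : ℝ, ∀ s u : ℝ, ‖g * Amat s * Nmat u‖ ≤ M → |s| ≤ S ∧ |u| ≤ S := by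
  set T := (‖g 0 0‖ + ‖g 0 1‖) * M with hT
  refine ⟨max (4 * T) (2 * T * Real.exp (2 * T)), fun s u hk => ?_⟩
  rw [mul_assoc] at hk
  set k := g * (Amat s * Nmat u) with hkdef
  obtain ⟨h1, h2, h3⟩ := isSU11_iff.1 hg
  have hrec : (Amat s * Nmat u) 0 0 = conj (g 0 0) * k 0 0 - g 0 1 * k 1 0 := by
    rw [hkdef, Matrix.mul_apply (M := g), Matrix.mul_apply (M := g), Fin.sum_univ_two,
      Fin.sum_univ_two, h1, h2]
    linear_combination -(Amat s * Nmat u) 0 0 * h3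
  have hb : ‖(Amat s * Nmat u) 0 0‖ ≤ T := by
    rw [hrec]
    refine (norm_sub_le _ _).trans ?_
    rw [norm_mul, norm_mul, RCLike.norm_conj, hT, add_mul]
    gcongr
    · exact (Matrix.norm_entry_le_entrywise_sup_norm k).trans hk
    · exact (Matrix.norm_entry_le_entrywise_sup_norm k).trans hk
  rw [Amat_mul_Nmat_apply_zero] at hb
  have hre := (Complex.abs_re_le_norm _).trans hb
  have him := (Complex.abs_im_le_norm _).trans hb
  simp only at hre him
  rw [abs_of_pos (Real.cosh_pos _)] at hre
  rw [abs_mul, abs_of_pos (Real.exp_pos _), abs_div, abs_two] at him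
  have hc : |s| / 2 ≤ 2 * T := by
    rw [← Real.cosh_abs, Real.cosh_eq, abs_div, abs_two] at hre
    have := Real.add_one_le_exp (|s| / 2)
    have := Real.exp_pos (-(|s| / 2))
    linarith
  refine ⟨le_max_of_le_left (by linarith), le_max_of_le_right ?_⟩
  have hs : -(2 * T) ≤ s / 2 := by
    have := neg_abs_le s
    linarith
  have he : 1 ≤ Real.exp (s / 2) * Real.exp (2 * T) := by
    rw [← Real.exp_add]
    exact Real.one_le_exp (by linarith)
  calc |u| ≤ |u| * (Real.exp (s / 2) * Real.exp (2 * T)) :=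
        le_mul_of_one_le_right (abs_nonneg _) he
    _ = 2 * (|u| / 2 * Real.exp (s / 2)) * Real.exp (2 * T) := by ring
    _ ≤ 2 * T * Real.exp (2 * T) := by gcongr

theorem pair_of_isSU11 {g : Matrix (Fin 2) (Fin 2) ℂ} (hg : IsSU11 g) :
    (g 0 0 + g 0 1) * conj (g 0 0 - g 0 1) + (g 0 0 - g 0 1) * conj (g 0 0 + g 0 1) = 2 := by
  obtain ⟨-, -, h⟩ := isSU11_iff.1 hg
  simp only [map_add, map_sub]
  linear_combination 2 * h

theorem moeb_one {g : Matrix (Fin 2) (Fin 2) ℂ} (hg : IsSU11 g) :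
    moeb g 1 = (g 0 0 + g 0 1) / conj (g 0 0 + g 0 1) := by
  obtain ⟨h1, h2, -⟩ := isSU11_iff.1 hg
  rw [moeb, h1, h2, map_add]
  ring_nf

theorem moeb_neg_one {g : Matrix (Fin 2) (Fin 2) ℂ} (hg : IsSU11 g) :
    moeb g (-1) = -(g 0 0 - g 0 1) / conj (g 0 0 - g 0 1) := by
  obtain ⟨h1, h2, -⟩ := isSU11_iff.1 hg
  rw [moeb, h1, h2, map_sub]
  ring_nf

theorem moeb_zero {g : Matrix (Fin 2) (Fin 2) ℂ} (hg : IsSU11 g) :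
    moeb g 0 = cay (g 0 0 + g 0 1) (g 0 0 - g 0 1) 1 := by
  obtain ⟨h1, h2, -⟩ := isSU11_iff.1 hg
  rw [moeb, h2, cay, map_add, map_sub, ← mul_div_mul_left _ _ (two_ne_zero (α := ℂ))]
  ring_nf

theorem exp_half_coe (s : ℝ) : (Real.cosh (s / 2) : ℂ) + Real.sinh (s / 2) = Real.exp (s / 2) := by
  rw [← Complex.ofReal_add, Real.cosh_add_sinh]

theorem moeb_frame_one (g : Matrix (Fin 2) (Fin 2) ℂ) (s u : ℝ) :
    moeb (g * Amat s * Nmat u) 1 = moeb g 1 := by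
  have hE : (Real.exp (s / 2) : ℂ) ≠ 0 := by exact_mod_cast (Real.exp_pos _).ne'
  simp only [moeb, Matrix.mul_apply, Fin.sum_univ_two, Amat, Nmat, Matrix.of_apply,
    Matrix.cons_val', Matrix.cons_val_zero, Matrix.cons_val_one, Matrix.cons_val_fin_one]
  rw [← mul_div_mul_left (g 0 0 * 1 + g 0 1) _ hE, ← exp_half_coe]
  congr 1 <;> ring

theorem moeb_frame_zero {g : Matrix (Fin 2) (Fin 2) ℂ} (hg : IsSU11 g) (s u : ℝ) :
    moeb (g * Amat s * Nmat u) 0 = cay (g 0 0 + g 0 1) (g 0 0 - g 0 1) (horo s u) := by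
  obtain ⟨h1, h2, -⟩ := isSU11_iff.1 hg
  have hE : (2 * Real.exp (s / 2) : ℂ) ≠ 0 :=
    mul_ne_zero two_ne_zero (by exact_mod_cast (Real.exp_pos _).ne')
  have hx : (Real.exp s : ℂ) = (Real.exp (s / 2) : ℂ) ^ 2 := by
    rw [← Complex.ofReal_pow, ← Real.exp_nat_mul]
    congr 2
    push_cast; ring
  have hcs : (Real.cosh (s / 2) : ℂ) ^ 2 - (Real.sinh (s / 2) : ℂ) ^ 2 = 1 := by
    exact_mod_cast Real.cosh_sq_sub_sinh_sq (s / 2)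
  simp only [moeb, cay, horo, Matrix.mul_apply, Fin.sum_univ_two, Amat, Nmat, Matrix.of_apply,
    Matrix.cons_val', Matrix.cons_val_zero, Matrix.cons_val_one, Matrix.cons_val_fin_one,
    h1, h2, map_add, map_sub]
  rw [← mul_div_mul_left _ _ hE, hx, ← exp_half_coe]
  congr 1
  · linear_combination (g 0 1 - g 0 0) * hcs
  · linear_combination (conj (g 0 0) - conj (g 0 1)) * hcs

theorem norm_sub_of_pair {p q : ℂ} (hpq : p * conj q + q * conj p = 2) :
    ‖p / conj p - -q / conj q‖ = 2 / (‖p‖ * ‖q‖) := by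
  have hp : conj p ≠ 0 := by simpa using left_ne_zero_of_pair hpq
  have hq : conj q ≠ 0 := by simpa using right_ne_zero_of_pair hpq
  have h : p / conj p - -q / conj q = 2 / (conj p * conj q) := by
    rw [div_sub_div _ _ hp hq, ← hpq]
    ring
  rw [h, norm_div, norm_mul, RCLike.norm_conj, RCLike.norm_conj, Complex.norm_ofNat]

theorem norm_eq_of_frame {g : Matrix (Fin 2) (Fin 2) ℂ} {b b' : ℂ} (hg : frameFor g b' b) :
    ‖g 0 0 + g 0 1‖ = ‖g 0 0 - g 0 1‖ := by
  obtain ⟨hSU, rfl, rfl, hn⟩ := hg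
  have hpq := pair_of_isSU11 hSU
  have h1 := Pk_cay_left hpq (w := 1) (by simp)
  have h2 := Pk_cay_right hpq (w := 1) (by simp)
  rw [← moeb_zero hSU, ← moeb_one hSU] at h1
  rw [← moeb_zero hSU, ← moeb_neg_one hSU] at h2
  rw [Pk, hn, ← Pk, h2] at h1
  simp only [Complex.one_re, one_mul, norm_one, one_pow, div_one] at h1
  exact ((pow_left_inj₀ (norm_nonneg _) (norm_nonneg _) two_ne_zero).1 h1).symm

theorem norm_horo_sq (s u : ℝ) : ‖horo s u‖ ^ 2 = Real.exp s ^ 2 * (1 + u ^ 2) := by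
  rw [← Complex.normSq_eq_norm_sq, Complex.normSq_apply, horo_re, horo_im]
  ring

/-- The product of Poisson kernel powers in horocyclic coordinates. -/
theorem Pk_cpow_mul_Pk_cpow {p q : ℂ} (hpq : p * conj q + q * conj p = 2) (hn : ‖p‖ = ‖q‖)
    (r r' s u : ℝ) :
    (Pk (cay p q (horo s u)) (p / conj p) : ℂ) ^ ((1 : ℂ) / 2 + Complex.I * (r : ℂ)) *
      (Pk (cay p q (horo s u)) (-q / conj q) : ℂ) ^ ((1 : ℂ) / 2 + Complex.I * (r' : ℂ)) =
    ((‖p‖ ^ 2 : ℝ) : ℂ) ^ (1 + Complex.I * ((r : ℂ) + (r' : ℂ))) *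
      (((1 + u ^ 2 : ℝ) : ℂ) ^ (-((1 : ℂ) / 2) - Complex.I * (r' : ℂ)) *
        Complex.exp (Complex.I * ((r : ℂ) - (r' : ℂ)) * (s : ℂ))) := by
  have hw : 0 < (horo s u).re := by simp [Real.exp_pos]
  have hp : 0 < ‖p‖ ^ 2 := by
    have := norm_pos_iff.2 (left_ne_zero_of_pair hpq)
    positivity
  have hu : 0 < 1 + u ^ 2 := by positivity
  have he := Real.exp_pos s
  rw [Pk_cay_left hpq hw, Pk_cay_right hpq hw, norm_horo_sq, horo_re, ← hn,
    show Real.exp s * ‖p‖ ^ 2 / (Real.exp s ^ 2 * (1 + u ^ 2)) =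
      ‖p‖ ^ 2 / (Real.exp s * (1 + u ^ 2)) by field_simp,
    ofReal_cpow_eq_exp (by positivity), ofReal_cpow_eq_exp (by positivity),
    ofReal_cpow_eq_exp hp, ofReal_cpow_eq_exp hu, ← Complex.exp_add, ← Complex.exp_add,
    ← Complex.exp_add, Real.log_mul he.ne' hp.ne',
    Real.log_div hp.ne' (by positivity), Real.log_mul he.ne' hu.ne', Real.log_exp]
  congr 1
  push_cast
  ring

theorem continuous_frame (g : Matrix (Fin 2) (Fin 2) ℂ) :
    Continuous fun x : ℝ × ℝ => g * Amat x.1 * Nmat x.2 := by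
  have hA : Continuous Amat := by
    refine continuous_matrix fun i j => ?_
    fin_cases i <;> fin_cases j <;> simp only [Amat] <;> simp <;> fun_prop
  have hN : Continuous Nmat := by
    refine continuous_matrix fun i j => ?_
    fin_cases i <;> fin_cases j <;> simp only [Nmat] <;> simp <;> fun_prop
  exact (continuous_const.matrix_mul (hA.comp continuous_fst)).matrix_mul
    (hN.comp continuous_snd)

end group

/-- The Patterson–Sullivan transform of `ℒa` at the spectral parameters
`(ir, b), (ir', b')` equals the Wigner transform of `a` at the same parameters. -/
theorem PS_of_Lop_eq_wigner
    (a : Matrix (Fin 2) (Fin 2) ℂ → ℝ → ℂ)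
    (hsm : ContDiff ℝ (⊤ : ℕ∞) fun p : Matrix (Fin 2) (Fin 2) ℂ × ℝ => a p.1 p.2)
    (hcs : HasCompactSupport fun p : Matrix (Fin 2) (Fin 2) ℂ × ℝ => a p.1 p.2)
    (hsym : ∀ (g : Matrix (Fin 2) (Fin 2) ℂ) (ρ : ℝ), IsSU11 g → a (-g) ρ = a g ρ)
    (b b' : ℂ) (hb : ‖b‖ = 1) (hb' : ‖b'‖ = 1) (hne : b ≠ b')
    (g₀ : Matrix (Fin 2) (Fin 2) ℂ) (hg₀ : frameFor g₀ b' b)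
    (r r' : ℝ) (A : ℂ → ℝ → ℂ)
    (hA : ∀ (g : Matrix (Fin 2) (Fin 2) ℂ) (ρ : ℝ), IsSU11 g → moeb g 1 = b →
      A (moeb g 0) ρ = a g ρ) :
    (∀ τ : ℝ, Integrable (fun q : ℝ × ℝ × ℝ =>
      ((1 + q.2.1 ^ 2 : ℝ) : ℂ) ^
          (-((1 : ℂ) / 2) - Complex.I * (((r + r') / 2 : ℝ) : ℂ)) *
        a (g₀ * Amat τ * Amat (q.1 - Real.log (1 + q.2.1 ^ 2) / 2) * Nmat q.2.1)
          q.2.2 *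
        Complex.exp (2 * Complex.I * ((q.2.2 : ℂ) - (((r + r') / 2 : ℝ) : ℂ)) *
          (q.1 : ℂ)))) ∧
    Integrable (fun τ : ℝ =>
      Lop a (g₀ * Amat τ) ((r + r') / 2) *
        Complex.exp (Complex.I * ((r : ℂ) - (r' : ℂ)) * (τ : ℂ))) ∧
    Integrable (fun z : ℂ =>
      A z r * (Pk z b : ℂ) ^ ((1 : ℂ) / 2 + Complex.I * (r : ℂ)) *
        (Pk z b' : ℂ) ^ ((1 : ℂ) / 2 + Complex.I * (r' : ℂ))) hypVol ∧
    (‖b - b'‖ : ℂ) ^ (-(1 + Complex.I * ((r : ℂ) + (r' : ℂ)))) *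
      (∫ τ : ℝ, Lop a (g₀ * Amat τ) ((r + r') / 2) *
        Complex.exp (Complex.I * ((r : ℂ) - (r' : ℂ)) * (τ : ℂ))) =
    ∫ z, A z r * (Pk z b : ℂ) ^ ((1 : ℂ) / 2 + Complex.I * (r : ℂ)) *
      (Pk z b' : ℂ) ^ ((1 : ℂ) / 2 + Complex.I * (r' : ℂ)) ∂hypVol := by

  obtain ⟨hSU, hb1, hb2, -⟩ := id hg₀
  set p := g₀ 0 0 + g₀ 0 1
  set q := g₀ 0 0 - g₀ 0 1
  have hpq : p * (starRingEnd ℂ) q + q * (starRingEnd ℂ) p = 2 := pair_of_isSU11 hSU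
  have hnorm : ‖p‖ = ‖q‖ := norm_eq_of_frame hg₀
  rw [moeb_one hSU] at hb1
  rw [moeb_neg_one hSU] at hb2
  obtain ⟨M, -, hM⟩ := exists_support_bound hcs
  obtain ⟨S₀, hS₀⟩ := exists_coord_bound hSU M
  obtain ⟨C, hC0, hC⟩ := exists_fourier_decay hsm hcs
  set K : ℝ → ℝ → ℝ → ℂ := fun s u ρ => a (g₀ * Amat s * Nmat u) ρ with hKdef
  have hK : Continuous fun x : ℝ × ℝ × ℝ => K x.1 x.2.1 x.2.2 :=
    hsm.continuous.comp (((continuous_frame g₀).comp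
      (by fun_prop : Continuous fun x : ℝ × ℝ × ℝ => (x.1, x.2.1))).prodMk (by fun_prop))
  have hS : ∀ s u ρ, K s u ρ ≠ 0 → |s| ≤ max S₀ M ∧ |u| ≤ max S₀ M ∧ |ρ| ≤ max S₀ M := by
    intro s u ρ h
    obtain ⟨h1, h2⟩ := hM _ _ h
    obtain ⟨h3, h4⟩ := hS₀ s u h1
    exact ⟨le_max_of_le_left h3, le_max_of_le_left h4, le_max_of_le_right h2⟩
  have hmul : ∀ σ x u ρ : ℝ, a (g₀ * Amat σ * Amat x * Nmat u) ρ = K (σ + x) u ρ := by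
    intro σ x u ρ
    rw [hKdef, mul_assoc g₀, Amat_mul_Amat]
  set c : ℂ := (2 : ℂ) ^ (1 + 2 * Complex.I * (((r + r') / 2 : ℝ) : ℂ)) / (Real.pi : ℂ) with hc
  set f : ℝ → ℂ := fun σ => (∫ τ : ℝ, ∫ u : ℝ, ∫ ρ : ℝ,
      ((1 + u ^ 2 : ℝ) : ℂ) ^ (-((1 : ℂ) / 2) - Complex.I * (((r + r') / 2 : ℝ) : ℂ)) *
        K (σ + (τ - Real.log (1 + u ^ 2) / 2)) u ρ *
        Complex.exp (2 * Complex.I * ((ρ : ℂ) - (((r + r') / 2 : ℝ) : ℂ)) * (τ : ℂ))) *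
      Complex.exp (Complex.I * ((r : ℂ) - (r' : ℂ)) * (σ : ℂ)) with hf
  have hLop : (fun τ : ℝ => Lop a (g₀ * Amat τ) ((r + r') / 2) *
      Complex.exp (Complex.I * ((r : ℂ) - (r' : ℂ)) * (τ : ℂ))) = fun τ => c * f τ := by
    funext σ
    simp only [Lop, hmul, hf, hc]
    ring
  obtain ⟨hfint, hfeq⟩ := integral_intertwining hK hS hC0 (fun s u τ => hC _ τ) rfl
    (f := f) (fun σ => rfl)
  set J : ℝ × ℝ → ℂ := fun x =>
    ((1 + x.2 ^ 2 : ℝ) : ℂ) ^ (-((1 : ℂ) / 2) - Complex.I * (r' : ℂ)) *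
      Complex.exp (Complex.I * ((r : ℂ) - (r' : ℂ)) * (x.1 : ℂ)) * K x.1 x.2 r with hJ
  have hJint : Integrable J := integrable_intertwining_slice hK hS r r'
  set κ : ℂ := ((‖p‖ ^ 2 : ℝ) : ℂ) ^ (1 + Complex.I * ((r : ℂ) + (r' : ℂ))) with hκ
  have hW : ∀ x : ℝ × ℝ, A (cay p q (horo x.1 x.2)) r *
      (Pk (cay p q (horo x.1 x.2)) b : ℂ) ^ ((1 : ℂ) / 2 + Complex.I * (r : ℂ)) *
      (Pk (cay p q (horo x.1 x.2)) b' : ℂ) ^ ((1 : ℂ) / 2 + Complex.I * (r' : ℂ)) =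
      κ * J x := by
    intro x
    have h1 : A (cay p q (horo x.1 x.2)) r = K x.1 x.2 r := by
      rw [← moeb_frame_zero hSU]
      refine hA _ _ ((hSU.mul (isSU11_Amat _)).mul (isSU11_Nmat _)) ?_
      rw [moeb_frame_one, moeb_one hSU, hb1]
    rw [h1, mul_assoc, ← hb1, ← hb2, Pk_cpow_mul_Pk_cpow hpq hnorm]
    simp only [hJ, hκ]
    ring
  obtain ⟨hV1, hV2⟩ := hypVol_horocyclic hpq (fun z => A z r *
    (Pk z b : ℂ) ^ ((1 : ℂ) / 2 + Complex.I * (r : ℂ)) *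
      (Pk z b' : ℂ) ^ ((1 : ℂ) / 2 + Complex.I * (r' : ℂ)))
  simp only [hW] at hV1 hV2
  refine ⟨fun τ => ?_, ?_, hV1.2 (hJint.const_mul κ), ?_⟩
  · simp only [hmul]
    exact integrable_intertwining_kernel hK hS τ _
  · rw [hLop]
    exact hfint.const_mul c
  · have hp0 : 0 < ‖p‖ := norm_pos_iff.2 (left_ne_zero_of_pair hpq)
    have hdist : ‖b - b'‖ = 2 / ‖p‖ ^ 2 := by
      rw [← hb1, ← hb2, norm_sub_of_pair hpq, ← hnorm, sq]
    have hconst : (‖b - b'‖ : ℂ) ^ (-(1 + Complex.I * ((r : ℂ) + (r' : ℂ)))) *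
        (c * π) = κ := by
      rw [hc, div_mul_cancel₀ _ (by exact_mod_cast Real.pi_ne_zero), hdist, hκ,
        ofReal_cpow_eq_exp (by positivity), ofReal_cpow_eq_exp (by positivity),
        ← Complex.ofReal_ofNat, ofReal_cpow_eq_exp (by positivity), ← Complex.exp_add,
        Real.log_div (by norm_num) (by positivity)]
      congr 1
      push_cast
      ring
    rw [hV2, hLop, integral_const_mul, hfeq, integral_const_mul, Measure.volume_eq_prod,
      integral_prod _ hJint, ← hconst]
    ring
end
end

section
/- (Plancherel formula for the Patterson–Sullivan transform.) Let a : S¹ × S¹ × ℝ × ℝ → ℂ be continuous with compact support, whose support is disjoint from the diagonal set {(b', b, t, r) : b = b'}. For r, r' ∈ ℝ and distinct b, b' ∈ S¹ set PSa(r, b, r', b') = |b−b'|^{−(1+i(r+r'))} · ∫_ℝ a(b', b, τ, (r+r')/2) e^{i(r−r')τ} dτ. Then ∫_{S¹} ∫_{S¹} ∫_ℝ ∫_ℝ |a(b', b, t, r)|² · (4π/|b−b'|²) · (2π)^{−1} r·tanh(πr) dt dr db db' = (1/π) · ∫_{S¹} ∫_{S¹} ∫_ℝ ∫_ℝ |PSa(r,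 b, r', b')|² · ((r+r')/2)·tanh(π(r+r')/2) dr dr' db db', where db, db' denote the normalized (probability) arclength measure on S¹. (The left side is the squared L² norm of a with respect to the Haar measure 4π db db' dt /|b−b'|² on the unit tangent bundle, tensored with the Plancherel measure.) -/
open Complex MeasureTheory Real

noncomputable section

/-- Normalized arclength (probability) measure on the unit circle S¹ ⊆ ℂ. -/
def circleMeasure : Measure ℂ :=
  (ENNReal.ofReal (2 * Real.pi))⁻¹ •
    (volume.restrict (Set.Ioc (0 : ℝ) (2 * Real.pi))).map
      (fun θ : ℝ => Complex.exp ((θ : ℂ) * Complex.I))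

open FourierTransform SchwartzMap in
theorem coeFn_fourier_toLp_two_ae_eq {f : ℝ → ℂ} (h1 : Integrable f) (h2 : MemLp f 2) :
    (𝓕 (h2.toLp f) : Lp ℂ 2 (volume : Measure ℝ)) =ᵐ[volume] 𝓕 f := by
  refine ae_eq_of_integral_contDiff_smul_eq ((Lp.memLp _).locallyIntegrable (by norm_num)) ?_ ?_
  · refine Continuous.locallyIntegrable ?_
    exact VectorFourier.fourierIntegral_continuous continuous_fourierChar continuous_inner h1
  intro g hg hgc
  have hc : HasCompactSupport (fun x => (g x : ℂ)) := hgc.comp_left Complex.ofReal_zero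
  let φ : 𝓢(ℝ, ℂ) := hc.toSchwartzMap (Complex.ofRealCLM.contDiff.comp hg)
  have hφ : ∀ x, φ x = g x := fun x => rfl
  have e0 := Lp.fourier_toTemperedDistribution_eq (h2.toLp f)
  have e1 := congrArg (fun T : 𝓢'(ℝ, ℂ) => T φ) e0
  simp only [TemperedDistribution.fourier_apply, Lp.toTemperedDistribution_apply, hφ] at e1
  have e2 : ∫ x, (𝓕 f x) • φ x = ∫ x, f x • 𝓕 φ x := by
    have := VectorFourier.integral_fourierIntegral_smul_eq_flip (L := innerₗ ℝ)
      continuous_fourierChar continuous_inner h1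
      (φ.integrable (μ := volume))
    simpa [SchwartzMap.fourier_coe] using! this
  have e3 : ∫ x, (𝓕 φ) x • (h2.toLp f : ℝ → ℂ) x = ∫ x, f x • 𝓕 φ x := by
    refine integral_congr_ae ?_
    filter_upwards [h2.coeFn_toLp] with x hx
    rw [hx, smul_eq_mul, smul_eq_mul, mul_comm]
  simp only [← Complex.coe_smul]
  rw [← e1, e3, ← e2]
  refine integral_congr_ae (ae_of_all _ fun x => ?_)
  simp [hφ, mul_comm]

open FourierTransform in
theorem memLp_two_fourier {f : ℝ → ℂ} (h1 : Integrable f) (h2 : MemLp f 2) : MemLp (𝓕 f) 2 :=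
  (memLp_congr_ae (coeFn_fourier_toLp_two_ae_eq h1 h2)).1 (Lp.memLp _)

open FourierTransform in
theorem integral_norm_sq_fourier_eq {f : ℝ → ℂ} (h1 : Integrable f) (h2 : MemLp f 2) :
    ∫ ξ, ‖𝓕 f ξ‖ ^ 2 = ∫ x, ‖f x‖ ^ 2 := by
  have key := Lp.inner_fourier_eq (h2.toLp f) (h2.toLp f)
  rw [L2.inner_def, L2.inner_def] at key
  simp only [inner_self_eq_norm_sq_to_K] at key
  have e1 : ∫ ξ, ((‖𝓕 f ξ‖ : ℝ) : ℂ) ^ 2 = ∫ x, ((‖f x‖ : ℝ) : ℂ) ^ 2 := by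
    refine Eq.trans (integral_congr_ae ?_) (key.trans (integral_congr_ae ?_))
    · filter_upwards [coeFn_fourier_toLp_two_ae_eq h1 h2] with x hx
      simp [hx]
    · filter_upwards [h2.coeFn_toLp] with x hx
      simp [hx]
  simp only [← Complex.ofReal_pow, integral_complex_ofReal] at e1
  exact Complex.ofReal_injective e1

open FourierTransform in
theorem integral_mul_cexp_eq_fourier (f : ℝ → ℂ) (s : ℝ) :
    ∫ τ : ℝ, f τ * Complex.exp (Complex.I * s * τ) = 𝓕 f (-(2 * Real.pi)⁻¹ * s) := by
  rw [Real.fourier_real_eq_integral_exp_smul]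
  refine integral_congr_ae (ae_of_all _ fun x => ?_)
  simp only [smul_eq_mul]
  rw [mul_comm]
  congr 2
  push_cast
  have : (Real.pi : ℂ) ≠ 0 := by exact_mod_cast Real.pi_ne_zero
  field_simp

theorem integrable_norm_sq_integral_mul_cexp {f : ℝ → ℂ} (h1 : Integrable f) (h2 : MemLp f 2) :
    Integrable fun s : ℝ => ‖∫ τ : ℝ, f τ * Complex.exp (Complex.I * s * τ)‖ ^ 2 := by
  simp only [integral_mul_cexp_eq_fourier]
  exact ((memLp_two_fourier h1 h2).integrable_norm_pow (by norm_num)).comp_mul_left'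
    (by simp [Real.pi_ne_zero])

theorem integral_norm_sq_integral_mul_cexp {f : ℝ → ℂ} (h1 : Integrable f) (h2 : MemLp f 2) :
    ∫ s : ℝ, ‖∫ τ : ℝ, f τ * Complex.exp (Complex.I * s * τ)‖ ^ 2
      = 2 * Real.pi * ∫ x, ‖f x‖ ^ 2 := by
  simp only [integral_mul_cexp_eq_fourier]
  rw [Measure.integral_comp_mul_left (fun x => ‖FourierTransform.fourier f x‖ ^ 2),
    integral_norm_sq_fourier_eq h1 h2]
  simp [abs_of_pos Real.pi_pos]

theorem measurePreserving_midpoint_sub :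
    MeasurePreserving (fun p : ℝ × ℝ => ((p.2 + p.1) / 2, p.2 - p.1))
      (volume.prod volume) (volume.prod volume) := by
  have hA : MeasurePreserving (fun p : ℝ × ℝ => (p.1, p.2 - p.1))
      (volume.prod volume) (volume.prod volume) :=
    (MeasurePreserving.id volume).skew_product (g := fun x y : ℝ => y - x) (by fun_prop)
      (ae_of_all _ fun x => (measurePreserving_sub_right volume x).map_eq)
  have hB : MeasurePreserving (fun p : ℝ × ℝ => (p.1, p.2 + p.1 / 2))
      (volume.prod volume) (volume.prod volume) :=
    (MeasurePreserving.id volume).skew_product (g := fun x y : ℝ => y + x / 2) (by fun_prop)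
      (ae_of_all _ fun x => (measurePreserving_add_right volume (x / 2)).map_eq)
  have hS : MeasurePreserving (Prod.swap : ℝ × ℝ → ℝ × ℝ)
      (volume.prod volume) (volume.prod volume) := Measure.measurePreserving_swap
  convert! hS.comp (hB.comp (hS.comp hA)) using 2 with p
  ext <;> simp
  ring

theorem circleMeasure_singleton (b : ℂ) : circleMeasure {b} = 0 := by
  have hm : Measurable fun θ : ℝ => Complex.exp ((θ : ℂ) * Complex.I) := by fun_prop
  rw [circleMeasure, Measure.smul_apply, Measure.map_apply hm (measurableSet_singleton b)]
  suffices h : ((fun θ : ℝ => Complex.exp ((θ : ℂ) * Complex.I)) ⁻¹' {b}).Countable by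
    rw [h.measure_zero, smul_zero]
  rcases Set.eq_empty_or_nonempty ((fun θ : ℝ => Complex.exp ((θ : ℂ) * Complex.I)) ⁻¹' {b})
    with h | ⟨θ₀, h₀⟩
  · simp [h]
  refine (Set.countable_range fun n : ℤ => θ₀ + n * (2 * Real.pi)).mono fun θ hθ => ?_
  have h : Complex.exp (θ * Complex.I) = Complex.exp (θ₀ * Complex.I) := hθ.trans h₀.symm
  obtain ⟨n, hn⟩ := Complex.exp_eq_exp_iff_exists_int.1 h
  refine ⟨n, ?_⟩
  have h2 := congrArg Complex.im hn
  simpa using h2.symm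

theorem integral_integral_norm_sq_integral_mul_cexp {g : ℝ → ℝ → ℂ} {w : ℝ → ℝ}
    (hg : Continuous fun p : ℝ × ℝ => g p.1 p.2)
    (hgc : HasCompactSupport fun p : ℝ × ℝ => g p.1 p.2) (hw : Continuous w) :
    ∫ r' : ℝ, ∫ r : ℝ, ‖∫ τ : ℝ, g τ ((r + r') / 2) *
        Complex.exp (Complex.I * ((r - r' : ℝ) : ℂ) * τ)‖ ^ 2 * w ((r + r') / 2) =
      2 * Real.pi * ∫ u : ℝ, ∫ t : ℝ, ‖g t u‖ ^ 2 * w u := by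
  have hcu (u : ℝ) : Continuous fun t => g t u := hg.comp (by fun_prop : Continuous fun t => (t, u))
  have hsu (u : ℝ) : HasCompactSupport fun t => g t u :=
    hgc.comp_isClosedEmbedding
      (g := fun t : ℝ => (t, u)) (Function.LeftInverse.isClosedEmbedding (f := Prod.fst)
        (fun _ => rfl) continuous_fst (by fun_prop))
  have h1 (u : ℝ) : Integrable fun t => g t u := (hcu u).integrable_of_hasCompactSupport (hsu u)
  have h2 (u : ℝ) : MemLp (fun t => g t u) 2 := (hcu u).memLp_of_hasCompactSupport (hsu u)
  set H : ℝ × ℝ → ℝ := fun p =>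
    ‖∫ τ : ℝ, g τ p.1 * Complex.exp (Complex.I * p.2 * τ)‖ ^ 2 * w p.1 with hH
  have hHm : AEStronglyMeasurable H (volume.prod volume) := by
    refine ((StronglyMeasurable.integral_prod_right (ν := volume)
      (f := fun (p : ℝ × ℝ) (τ : ℝ) => g τ p.1 * Complex.exp (Complex.I * p.2 * τ))
      ?_).norm.pow 2 |>.mul ?_).aestronglyMeasurable
    · refine Continuous.stronglyMeasurable ?_
      exact (hg.comp (by fun_prop : Continuous fun q : (ℝ × ℝ) × ℝ => (q.2, q.1.1))).mul
        (by fun_prop)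
    · exact (hw.comp continuous_fst).stronglyMeasurable
  have hK : Integrable (fun p : ℝ × ℝ => ‖g p.2 p.1‖ ^ 2 * |w p.1|) (volume.prod volume) := by
    have hsw : HasCompactSupport fun p : ℝ × ℝ => g p.2 p.1 :=
      hgc.comp_homeomorph (Homeomorph.prodComm ℝ ℝ)
    refine Continuous.integrable_of_hasCompactSupport ?_ ?_
    · exact ((hg.comp continuous_swap).norm.pow 2).mul (hw.comp continuous_fst).abs
    · refine HasCompactSupport.mul_right ?_
      exact hsw.comp_left (g := fun z : ℂ => ‖z‖ ^ 2) (by simp)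
  have hHi : Integrable H (volume.prod volume) := by
    refine (integrable_prod_iff hHm).2 ⟨ae_of_all _ fun u => ?_, ?_⟩
    · exact (integrable_norm_sq_integral_mul_cexp (h1 u) (h2 u)).mul_const (w u)
    · refine (hK.integral_prod_left.const_mul (2 * Real.pi)).congr (ae_of_all _ fun u => ?_)
      simp only [hH, norm_mul, norm_pow, norm_norm]
      simp only [Real.norm_eq_abs]
      rw [integral_mul_const, integral_mul_const,
        integral_norm_sq_integral_mul_cexp (h1 u) (h2 u)]
      ring
  have hT := measurePreserving_midpoint_sub
  have hHT : Integrable (fun p : ℝ × ℝ => H ((p.2 + p.1) / 2, p.2 - p.1))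
      (volume.prod volume) := hT.integrable_comp_of_integrable hHi
  calc
    _ = ∫ p : ℝ × ℝ, H ((p.2 + p.1) / 2, p.2 - p.1) ∂(volume.prod volume) :=
      (integral_prod _ hHT).symm
    _ = ∫ p, H p ∂(volume.prod volume) := by
      conv_rhs => rw [← hT.map_eq]
      rw [integral_map hT.aemeasurable (by rw [hT.map_eq]; exact hHm)]
    _ = ∫ u, ∫ s, H (u, s) := integral_prod _ hHi
    _ = _ := by
      rw [← integral_const_mul]
      refine integral_congr_ae (ae_of_all _ fun u => ?_)
      simp only [hH]
      rw [integral_mul_const, integral_mul_const,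
        integral_norm_sq_integral_mul_cexp (h1 u) (h2 u), mul_assoc]

/-- Plancherel formula for the Patterson–Sullivan transform: the L²-norm of `a`
with respect to Haar measure `4π db db' dt/|b−b'|²` tensored with Plancherel
measure equals `(1/π)` times the weighted L²-norm of its PS-transform. -/
theorem PS_transform_plancherel
    (a : ℂ → ℂ → ℝ → ℝ → ℂ)
    (hcont : Continuous fun p : ℂ × ℂ × ℝ × ℝ => a p.1 p.2.1 p.2.2.1 p.2.2.2)
    (hcs : HasCompactSupport fun p : ℂ × ℂ × ℝ × ℝ => a p.1 p.2.1 p.2.2.1 p.2.2.2)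
    (hdiag : ∀ p ∈ tsupport (fun p : ℂ × ℂ × ℝ × ℝ => a p.1 p.2.1 p.2.2.1 p.2.2.2),
      p.1 ≠ p.2.1)
    (PSa : ℝ → ℂ → ℝ → ℂ → ℂ)
    (hPSa : ∀ (r r' : ℝ) (b b' : ℂ), b ≠ b' → PSa r b r' b' =
      (‖b - b'‖ : ℂ) ^ (-(1 + Complex.I * ((r : ℂ) + (r' : ℂ)))) *
        ∫ τ : ℝ, a b' b τ ((r + r') / 2) *
          Complex.exp (Complex.I * ((r : ℂ) - (r' : ℂ)) * (τ : ℂ))) :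
    (∫ b', (∫ b, (∫ r : ℝ, ∫ t : ℝ,
        ‖a b' b t r‖ ^ 2 * (4 * Real.pi / ‖b - b'‖ ^ 2) *
          ((2 * Real.pi)⁻¹ * r * Real.tanh (Real.pi * r)))
        ∂circleMeasure) ∂circleMeasure) =
    (1 / Real.pi) * ∫ b', (∫ b, (∫ r' : ℝ, ∫ r : ℝ,
        ‖PSa r b r' b'‖ ^ 2 * ((r + r') / 2) * Real.tanh (Real.pi * (r + r') / 2))
        ∂circleMeasure) ∂circleMeasure := by
  have htanh : Continuous Real.tanh := by
    have : Real.tanh = fun x => Real.sinh x / Real.cosh x := funext Real.tanh_eq_sinh_div_cosh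
    rw [this]
    exact Real.continuous_sinh.div Real.continuous_cosh fun x => (Real.cosh_pos x).ne'
  rw [← integral_const_mul]
  refine integral_congr_ae (ae_of_all _ fun b' => ?_)
  simp only
  rw [← integral_const_mul]
  have hne : ∀ᵐ b ∂circleMeasure, b ≠ b' := by
    rw [ae_iff]
    simpa using circleMeasure_singleton b'
  refine integral_congr_ae ?_
  filter_upwards [hne] with b hb
  have hpos : 0 < ‖b - b'‖ := norm_pos_iff.2 (sub_ne_zero.2 hb)
  have hι : Topology.IsClosedEmbedding fun p : ℝ × ℝ => (b', b, p) :=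
    Function.LeftInverse.isClosedEmbedding (f := fun q : ℂ × ℂ × ℝ × ℝ => q.2.2)
      (fun _ => rfl) (by fun_prop) (by fun_prop)
  have key := integral_integral_norm_sq_integral_mul_cexp (g := a b' b)
    (w := fun u => u * Real.tanh (Real.pi * u)) (hcont.comp hι.continuous)
    (hcs.comp_isClosedEmbedding hι)
    (continuous_id.mul (htanh.comp (continuous_const.mul continuous_id)))
  have hR (r' r : ℝ) : ‖PSa r b r' b'‖ ^ 2 * ((r + r') / 2) *
        Real.tanh (Real.pi * (r + r') / 2) =
      (‖b - b'‖ ^ 2)⁻¹ * (‖∫ τ : ℝ, a b' b τ ((r + r') / 2) *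
        Complex.exp (Complex.I * ((r - r' : ℝ) : ℂ) * τ)‖ ^ 2 *
          ((r + r') / 2 * Real.tanh (Real.pi * ((r + r') / 2)))) := by
    have hn : ‖(‖b - b'‖ : ℂ) ^ (-(1 + Complex.I * ((r : ℂ) + (r' : ℂ))))‖ = ‖b - b'‖⁻¹ := by
      rw [Complex.norm_cpow_eq_rpow_re_of_pos hpos]
      simp [Real.rpow_neg_one]
    rw [hPSa r r' b b' hb, norm_mul, hn, mul_pow, inv_pow, Complex.ofReal_sub, mul_div_assoc]
    ring
  have hL (r t : ℝ) : ‖a b' b t r‖ ^ 2 * (4 * Real.pi / ‖b - b'‖ ^ 2) *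
        ((2 * Real.pi)⁻¹ * r * Real.tanh (Real.pi * r)) =
      2 * (‖b - b'‖ ^ 2)⁻¹ * (‖a b' b t r‖ ^ 2 * (r * Real.tanh (Real.pi * r))) := by
    field_simp
    ring
  simp only [hR, hL, integral_const_mul]
  rw [key]
  generalize ∫ u : ℝ, ∫ t : ℝ, ‖a b' b t u‖ ^ 2 * (u * Real.tanh (Real.pi * u)) = J
  field_simp
end
end
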